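/- Fix an integer k ≥ 1 and constants A_0, A_1, A_2, … . Let h ∈ (0,1] and N > 0, let v : ℝ² → ℂ be smooth with supp v ⊆ [−1,1]² and ‖(h^{k+1} ∂_{x₂}^{k+1})^{M} v‖_{L²(ℝ²)} ≤ A_M h^{M} N for every integer M ≥ 0, and let f ∈ C_c^∞(ℝ;ℂ). Let χ ∈ C^∞(ℝ;ℝ) with 0 ≤ χ ≤ 1 and supp χ ⊆ [1/2, 3/2]. Then for every integer M ≥ 0 there is a constant C_M, depending only on f, χ, k, M and the constants A_i (and independent of h, a, j, v, N), such that for every integer j ≥ 1 and every a with |a| ≥ 1: ( ∬_{ℝ²} | χ(2^{−j} h^{−1/(k+1)} |ξ₂|) · F_h[X_v(a,b,·)](ξ₂) |² dξ₂ db )^{1/2} ≤ C_M 2^{−jM} N. -/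

import Mathlib

open MeasureTheory Real

/-- The wavelet coefficient in the first variable:
`X_v(a,b,x₂) = |a|^{-1/2} ∫ f(a⁻¹(y₁-b)) v(y₁,x₂) dy₁`. -/
noncomputable def Xv (f : ℝ → ℂ) (v : ℝ × ℝ → ℂ) (a b x₂ : ℝ) : ℂ :=
  ((|a| ^ (-(1 : ℝ) / 2) : ℝ) : ℂ) * ∫ y₁ : ℝ, f ((y₁ - b) / a) * v (y₁, x₂)

/-- The semiclassical Fourier transform in one variable:
`F_h[w](ξ) = (2πh)^{-1/2} ∫ e^{-ixξ/h} w(x) dx`. -/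
noncomputable def Fh (h : ℝ) (w : ℝ → ℂ) (ξ : ℝ) : ℂ :=
  (((2 * π * h) ^ (-(1 : ℝ) / 2) : ℝ) : ℂ) *
    ∫ x : ℝ, Complex.exp (-Complex.I * (x : ℂ) * (ξ : ℂ) / (h : ℂ)) * w x

open scoped FourierTransform ContDiff

theorem Fh_eq_fourier (h : ℝ) (w : ℝ → ℂ) (ξ : ℝ) :
    Fh h w ξ = (((2 * π * h) ^ (-(1 : ℝ) / 2) : ℝ) : ℂ) * 𝓕 w (ξ / (2 * π * h)) := by
  rw [Fh, Real.fourier_real_eq_integral_exp_smul]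
  congr 1
  refine integral_congr_ae (ae_of_all _ fun x => ?_)
  simp only [smul_eq_mul]
  congr 2
  by_cases hh : h = 0
  · simp [hh]
  have : (π : ℂ) ≠ 0 := by exact_mod_cast pi_ne_zero
  have : (h : ℂ) ≠ 0 := by exact_mod_cast hh
  push_cast
  field_simp

theorem rpow_neg_half_sq {t : ℝ} (ht : 0 ≤ t) : (t ^ (-(1 : ℝ) / 2)) ^ 2 = t⁻¹ := by
  rw [← rpow_natCast, ← rpow_mul ht, ← rpow_neg_one]
  norm_num

theorem norm_sq_Fh {h : ℝ} (hh : 0 < h) (w : ℝ → ℂ) (ξ : ℝ) :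
    ‖Fh h w ξ‖ ^ 2 = (2 * π * h)⁻¹ * ‖𝓕 w (ξ / (2 * π * h))‖ ^ 2 := by
  have h0 : 0 ≤ 2 * π * h := by positivity
  rw [Fh_eq_fourier, norm_mul, mul_pow, Complex.norm_real, Real.norm_eq_abs, sq_abs,
    rpow_neg_half_sq h0]

theorem integrable_norm_sq_Fh {h : ℝ} (hh : 0 < h) {w : ℝ → ℂ} (hw : ContDiff ℝ ∞ w)
    (hc : HasCompactSupport w) : Integrable fun ξ => ‖Fh h w ξ‖ ^ 2 := by
  simp_rw [norm_sq_Fh hh]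
  have h1 : Integrable fun η => ‖𝓕 (hc.toSchwartzMap hw) η‖ ^ 2 :=
    ((𝓕 (hc.toSchwartzMap hw)).memLp 2).integrable_norm_pow (by norm_num)
  rw [SchwartzMap.fourier_coe] at h1
  exact (h1.comp_div (by positivity)).const_mul _

theorem integral_norm_sq_Fh {h : ℝ} (hh : 0 < h) {w : ℝ → ℂ} (hw : ContDiff ℝ ∞ w)
    (hc : HasCompactSupport w) : ∫ ξ, ‖Fh h w ξ‖ ^ 2 = ∫ x, ‖w x‖ ^ 2 := by
  have h0 : 0 < 2 * π * h := by positivity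
  simp_rw [norm_sq_Fh hh]
  rw [integral_const_mul, Measure.integral_comp_div (fun η => ‖𝓕 w η‖ ^ 2), abs_of_pos h0,
    smul_eq_mul, inv_mul_cancel_left₀ h0.ne']
  have := SchwartzMap.integral_norm_sq_fourier (hc.toSchwartzMap hw)
  rwa [SchwartzMap.fourier_coe] at this

theorem hasCompactSupport_iteratedDeriv {w : ℝ → ℂ} (hc : HasCompactSupport w) (n : ℕ) :
    HasCompactSupport (iteratedDeriv n w) := by
  induction n with
  | zero => simpa using hc
  | succ n ih => rw [iteratedDeriv_succ]; exact ih.deriv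

theorem Fh_iteratedDeriv (h : ℝ) {w : ℝ → ℂ} (hw : ContDiff ℝ ∞ w)
    (hc : HasCompactSupport w) (n : ℕ) (ξ : ℝ) :
    Fh h (iteratedDeriv n w) ξ = (Complex.I * ξ / h) ^ n * Fh h w ξ := by
  have hi : ∀ m : ℕ, (m : ℕ∞) ≤ (⊤ : ℕ∞) → Integrable (iteratedDeriv m w) := fun m _ =>
    (hw.continuous_iteratedDeriv m (by exact_mod_cast le_top)).integrable_of_hasCompactSupport
      (hasCompactSupport_iteratedDeriv hc m)
  rw [Fh_eq_fourier, Fh_eq_fourier, Real.fourier_iteratedDeriv hw hi le_top]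
  have : (2 * π * Complex.I * ((ξ / (2 * π * h) : ℝ) : ℂ)) = Complex.I * ξ / h := by
    have : (π : ℂ) ≠ 0 := by exact_mod_cast pi_ne_zero
    push_cast
    field_simp
  dsimp only
  rw [this, smul_eq_mul]
  ring

/-- A cutoff to frequencies `|ξ| ≥ K` gains a factor `h / K` for every derivative. -/
theorem integral_norm_sq_cutoff_mul_Fh_le {h K : ℝ} (hh : 0 < h) (hK : 0 < K) {φ : ℝ → ℝ}
    (hφ : ∀ ξ, |φ ξ| ≤ 1) (hφK : ∀ ξ, |ξ| < K → φ ξ = 0) {w : ℝ → ℂ} (hw : ContDiff ℝ ∞ w)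
    (hc : HasCompactSupport w) (n : ℕ) :
    ∫ ξ, ‖(φ ξ : ℂ) * Fh h w ξ‖ ^ 2 ≤ ((h / K) ^ n) ^ 2 * ∫ x, ‖iteratedDeriv n w x‖ ^ 2 := by
  have hw' : ContDiff ℝ ∞ (iteratedDeriv n w) := by
    rw [iteratedDeriv_eq_iterate]
    exact hw.iterate_deriv n
  have hc' := hasCompactSupport_iteratedDeriv hc n
  rw [← integral_norm_sq_Fh hh hw' hc', ← integral_const_mul]
  refine integral_mono_of_nonneg (ae_of_all _ fun ξ => by positivity)
    ((integrable_norm_sq_Fh hh hw' hc').const_mul _) (ae_of_all _ fun ξ => ?_)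
  dsimp only
  rcases lt_or_ge |ξ| K with hξ | hξ
  · rw [hφK ξ hξ]
    simp only [Complex.ofReal_zero, zero_mul, norm_zero, zero_pow two_ne_zero]
    positivity
  · rw [← mul_pow, Fh_iteratedDeriv h hw hc, norm_mul, norm_mul, norm_pow, norm_div, norm_mul,
      Complex.norm_I, Complex.norm_real, Complex.norm_real, Complex.norm_real, one_mul, ← mul_assoc,
      ← mul_pow, Real.norm_eq_abs, Real.norm_eq_abs, Real.norm_eq_abs, abs_of_pos hh]
    refine pow_le_pow_left₀ (by positivity) (mul_le_mul_of_nonneg_right ?_ (norm_nonneg _)) 2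
    refine (hφ ξ).trans (one_le_pow₀ ?_)
    rw [div_mul_div_comm, mul_comm h, one_le_div (by positivity)]
    exact mul_le_mul_of_nonneg_right hξ hh.le

/-- The partial derivative in the second variable. -/
noncomputable def partialSnd (v : ℝ × ℝ → ℂ) (p : ℝ × ℝ) : ℂ := fderiv ℝ v p (0, 1)

theorem ContDiff.partialSnd {v : ℝ × ℝ → ℂ} (hv : ContDiff ℝ ∞ v) :
    ContDiff ℝ ∞ (partialSnd v) :=
  (hv.fderiv_right (m := ∞) (by simp)).clm_apply contDiff_const

theorem hasDerivAt_partialSnd {v : ℝ × ℝ → ℂ} (hv : ContDiff ℝ ∞ v) (y x : ℝ) :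
    HasDerivAt (fun s => v (y, s)) (partialSnd v (y, x)) x := by
  have h1 : HasFDerivAt v (fderiv ℝ v (y, x)) (y, x) :=
    (hv.differentiable (by simp) (y, x)).hasFDerivAt
  exact h1.comp_hasDerivAt x ((hasDerivAt_const x y).prodMk (hasDerivAt_id x))

theorem contDiff_iterate_partialSnd {v : ℝ × ℝ → ℂ} (hv : ContDiff ℝ ∞ v) (n : ℕ) :
    ContDiff ℝ ∞ (partialSnd^[n] v) := by
  induction n with
  | zero => exact hv
  | succ n ih => rw [Function.iterate_succ_apply']; exact ih.partialSnd

theorem tsupport_iterate_partialSnd (v : ℝ × ℝ → ℂ) (n : ℕ) :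
    tsupport (partialSnd^[n] v) ⊆ tsupport v := by
  induction n with
  | zero => exact subset_rfl
  | succ n ih =>
    rw [Function.iterate_succ_apply']
    exact (tsupport_fderiv_apply_subset ℝ _).trans ih

theorem iteratedDeriv_slice {v : ℝ × ℝ → ℂ} (hv : ContDiff ℝ ∞ v) (n : ℕ) (y x : ℝ) :
    iteratedDeriv n (fun s => v (y, s)) x = partialSnd^[n] v (y, x) := by
  induction n generalizing v with
  | zero => simp
  | succ n ih =>
    rw [iteratedDeriv_succ', Function.iterate_succ_apply, ← ih hv.partialSnd]
    congr 1
    exact funext fun s => (hasDerivAt_partialSnd hv y s).deriv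

theorem hasCompactSupport_of_tsupport_subset_box {v : ℝ × ℝ → ℂ}
    (hs : tsupport v ⊆ Set.Icc (-1 : ℝ) 1 ×ˢ Set.Icc (-1 : ℝ) 1) : HasCompactSupport v :=
  (isCompact_Icc.prod isCompact_Icc).of_isClosed_subset (isClosed_tsupport v) hs

theorem integrable_comp_sub_div {g : ℝ → ℂ} (hg : Integrable g) {a : ℝ} (ha : a ≠ 0) (b : ℝ) :
    Integrable fun y => g ((y - b) / a) :=
  (hg.comp_div ha).comp_sub_right b

theorem hasDerivAt_Xv {f : ℝ → ℂ} (hf : Continuous f) (hfc : HasCompactSupport f)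
    {v : ℝ × ℝ → ℂ} (hv : ContDiff ℝ ∞ v) (hvc : HasCompactSupport v) {a : ℝ} (ha : a ≠ 0)
    (b x : ℝ) : HasDerivAt (Xv f v a b) (Xv f (partialSnd v) a b x) x := by
  have hfi := integrable_comp_sub_div (hf.integrable_of_hasCompactSupport hfc) ha b
  have hf' : Continuous fun y => f ((y - b) / a) := by fun_prop
  have hv' : Continuous (partialSnd v) := hv.partialSnd.continuous
  have hvcont : Continuous v := hv.continuous
  obtain ⟨B, hB⟩ := hvcont.bounded_above_of_compact_support hvc
  obtain ⟨B', hB'⟩ := hv'.bounded_above_of_compact_support (hvc.fderiv_apply ℝ (0, 1))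
  refine HasDerivAt.const_mul _ (hasDerivAt_integral_of_dominated_loc_of_deriv_le
    (F := fun s y => f ((y - b) / a) * v (y, s))
    (F' := fun s y => f ((y - b) / a) * partialSnd v (y, s)) (bound := fun y => ‖f ((y - b) / a)‖ * B') Filter.univ_mem
    (Filter.Eventually.of_forall fun s => ?_) ?_ ?_ ?_ (hfi.norm.mul_const _) ?_).2
  · exact Continuous.aestronglyMeasurable (by fun_prop)
  · exact hfi.mul_bdd (c := B) (Continuous.aestronglyMeasurable (by fun_prop))
      (ae_of_all _ fun y => hB _)
  · exact Continuous.aestronglyMeasurable (by fun_prop)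
  · refine ae_of_all _ fun y s _ => ?_
    rw [norm_mul]
    exact mul_le_mul_of_nonneg_left (hB' _) (norm_nonneg _)
  · exact ae_of_all _ fun y s _ => (hasDerivAt_partialSnd hv y s).const_mul _

theorem iteratedDeriv_Xv {f : ℝ → ℂ} (hf : Continuous f) (hfc : HasCompactSupport f)
    {v : ℝ × ℝ → ℂ} (hv : ContDiff ℝ ∞ v) (hvc : HasCompactSupport v) {a : ℝ} (ha : a ≠ 0)
    (b : ℝ) (n : ℕ) : iteratedDeriv n (Xv f v a b) = Xv f (partialSnd^[n] v) a b := by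
  induction n generalizing v with
  | zero => simp
  | succ n ih =>
    rw [iteratedDeriv_succ', Function.iterate_succ_apply,
      ← ih hv.partialSnd (hvc.fderiv_apply ℝ (0, 1))]
    congr 1
    exact funext fun s => (hasDerivAt_Xv hf hfc hv hvc ha b s).deriv

theorem contDiff_Xv {f : ℝ → ℂ} (hf : Continuous f) (hfc : HasCompactSupport f)
    {v : ℝ × ℝ → ℂ} (hv : ContDiff ℝ ∞ v) (hvc : HasCompactSupport v) {a : ℝ} (ha : a ≠ 0)
    (b : ℝ) : ContDiff ℝ ∞ (Xv f v a b) := by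
  refine contDiff_of_differentiable_iteratedDeriv fun n _ => ?_
  rw [iteratedDeriv_Xv hf hfc hv hvc ha]
  exact fun x => (hasDerivAt_Xv hf hfc (contDiff_iterate_partialSnd hv n)
    (hvc.of_isClosed_subset (isClosed_tsupport _) (tsupport_iterate_partialSnd v n))
    ha b x).differentiableAt

theorem hasCompactSupport_Xv (f : ℝ → ℂ) {v : ℝ × ℝ → ℂ}
    (hs : tsupport v ⊆ Set.Icc (-1 : ℝ) 1 ×ˢ Set.Icc (-1 : ℝ) 1) (a b : ℝ) :
    HasCompactSupport (Xv f v a b) := by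
  refine HasCompactSupport.intro (isCompact_Icc (a := (-1 : ℝ)) (b := 1)) fun x hx => ?_
  have : ∀ y, v (y, x) = 0 := fun y => image_eq_zero_of_notMem_tsupport fun hm => hx (hs hm).2
  simp [Xv, this]

theorem norm_integral_mul_sq_le {α : Type*} [MeasurableSpace α] {μ : Measure α} {u w : α → ℂ}
    (hu : MemLp u 2 μ) (hw : MemLp w 2 μ) :
    ‖∫ y, u y * w y ∂μ‖ ^ 2 ≤ (∫ y, ‖u y‖ ^ 2 ∂μ) * ∫ y, ‖w y‖ ^ 2 ∂μ := by
  have h2 : ENNReal.ofReal 2 = 2 := by norm_num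
  have h1 := integral_mul_norm_le_Lp_mul_Lq (μ := μ) (f := u) (g := w) HolderConjugate.two_two
    (by rwa [h2]) (by rwa [h2])
  simp only [rpow_two] at h1
  rw [← mul_rpow (by positivity) (by positivity), ← sqrt_eq_rpow] at h1
  have h3 : ‖∫ y, u y * w y ∂μ‖ ≤ ∫ y, ‖u y‖ * ‖w y‖ ∂μ := by
    simpa using norm_integral_le_integral_norm (μ := μ) fun y => u y * w y
  exact (pow_le_pow_left₀ (norm_nonneg _) (h3.trans h1) 2).trans_eq (sq_sqrt (by positivity))

/-- The local `L²` mass on `[-1, 1]` of the wavelet at scale `a` and position `b`. -/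
noncomputable def waveletMass (f : ℝ → ℂ) (a b : ℝ) : ℝ :=
  ∫ y in Set.Icc (-1 : ℝ) 1, ‖f ((y - b) / a)‖ ^ 2

theorem norm_sq_Xv_le {f : ℝ → ℂ} (hf : Continuous f) (hfc : HasCompactSupport f)
    {v : ℝ × ℝ → ℂ} (hv : Continuous v)
    (hs : tsupport v ⊆ Set.Icc (-1 : ℝ) 1 ×ˢ Set.Icc (-1 : ℝ) 1) (a b x : ℝ) :
    ‖Xv f v a b x‖ ^ 2 ≤ |a|⁻¹ * waveletMass f a b * ∫ y, ‖v (y, x)‖ ^ 2 := by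
  obtain ⟨B, hB⟩ := hf.bounded_above_of_compact_support hfc
  obtain ⟨B', hB'⟩ := hv.bounded_above_of_compact_support
    (hasCompactSupport_of_tsupport_subset_box hs)
  have hz : ∀ y, y ∉ Set.Icc (-1 : ℝ) 1 → v (y, x) = 0 := fun y hy =>
    image_eq_zero_of_notMem_tsupport fun hm => hy (hs hm).1
  have e1 : ∫ y, f ((y - b) / a) * v (y, x)
      = ∫ y in Set.Icc (-1 : ℝ) 1, f ((y - b) / a) * v (y, x) :=
    (setIntegral_eq_integral_of_forall_compl_eq_zero fun y hy => by simp [hz y hy]).symm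
  have e2 : ∫ y, ‖v (y, x)‖ ^ 2 = ∫ y in Set.Icc (-1 : ℝ) 1, ‖v (y, x)‖ ^ 2 :=
    (setIntegral_eq_integral_of_forall_compl_eq_zero fun y hy => by simp [hz y hy]).symm
  rw [Xv, norm_mul, mul_pow, Complex.norm_real, Real.norm_eq_abs, sq_abs,
    rpow_neg_half_sq (abs_nonneg a), mul_assoc, e1, e2]
  refine mul_le_mul_of_nonneg_left (norm_integral_mul_sq_le ?_ ?_) (by positivity)
  · exact MemLp.of_bound (Continuous.aestronglyMeasurable (by fun_prop)) B
      (ae_of_all _ fun y => hB _)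
  · exact MemLp.of_bound (Continuous.aestronglyMeasurable (by fun_prop)) B'
      (ae_of_all _ fun y => hB' _)

theorem integral_norm_sq_Xv_le {f : ℝ → ℂ} (hf : Continuous f) (hfc : HasCompactSupport f)
    {v : ℝ × ℝ → ℂ} (hv : Continuous v)
    (hs : tsupport v ⊆ Set.Icc (-1 : ℝ) 1 ×ˢ Set.Icc (-1 : ℝ) 1) (a b : ℝ) :
    ∫ x, ‖Xv f v a b x‖ ^ 2 ≤ |a|⁻¹ * waveletMass f a b * ∫ q, ‖v q‖ ^ 2 := by
  have hi : Integrable (fun q => ‖v q‖ ^ 2) (volume.prod volume) :=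
    (hv.memLp_of_hasCompactSupport (p := 2)
      (hasCompactSupport_of_tsupport_subset_box hs)).integrable_norm_pow (by norm_num)
  rw [Measure.volume_eq_prod, integral_prod_symm _ hi, ← integral_const_mul]
  exact integral_mono_of_nonneg (ae_of_all _ fun x => by positivity)
    (hi.integral_prod_right.const_mul _) (ae_of_all _ fun x => norm_sq_Xv_le hf hfc hv hs a b x)

theorem integrable_integral_waveletMass {f : ℝ → ℂ} (hf : Continuous f)
    (hfc : HasCompactSupport f) {a : ℝ} (ha : a ≠ 0) :
    Integrable (waveletMass f a) ∧ ∫ b, waveletMass f a b = 2 * (|a| * ∫ t, ‖f t‖ ^ 2) := by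
  have hfi : Integrable fun t => ‖f t‖ ^ 2 :=
    (hf.memLp_of_hasCompactSupport (p := 2) hfc).integrable_norm_pow (by norm_num)
  have hb : ∀ y, ∫ b, ‖f ((y - b) / a)‖ ^ 2 = |a| * ∫ t, ‖f t‖ ^ 2 := fun y => by
    rw [integral_sub_left_eq_self (fun s => ‖f (s / a)‖ ^ 2) volume y,
      Measure.integral_comp_div (fun s => ‖f s‖ ^ 2), smul_eq_mul]
  have hi : Integrable (fun q : ℝ × ℝ => ‖f ((q.1 - q.2) / a)‖ ^ 2)
      ((volume.restrict (Set.Icc (-1 : ℝ) 1)).prod volume) := by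
    rw [integrable_prod_iff (Continuous.aestronglyMeasurable (by fun_prop))]
    refine ⟨ae_of_all _ fun y => (hfi.comp_div ha).comp_sub_left y, ?_⟩
    simp only [norm_pow, norm_norm, hb]
    exact integrable_const _
  refine ⟨hi.integral_prod_right, ?_⟩
  simp only [waveletMass]
  rw [← integral_prod_symm _ hi, integral_prod _ hi]
  simp only [hb]
  simp [integral_const]
  norm_num

theorem integral_norm_sq_cutoff_mul_Fh_Xv_le {h K a : ℝ} (hh : 0 < h) (hK : 0 < K) (ha : a ≠ 0)
    {φ : ℝ → ℝ} (hφ : ∀ ξ, |φ ξ| ≤ 1) (hφK : ∀ ξ, |ξ| < K → φ ξ = 0)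
    {f : ℝ → ℂ} (hf : Continuous f) (hfc : HasCompactSupport f)
    {v : ℝ × ℝ → ℂ} (hv : ContDiff ℝ ∞ v)
    (hs : tsupport v ⊆ Set.Icc (-1 : ℝ) 1 ×ˢ Set.Icc (-1 : ℝ) 1) (n : ℕ) :
    ∫ p : ℝ × ℝ, ‖(φ p.1 : ℂ) * Fh h (Xv f v a p.2) p.1‖ ^ 2 ≤
      ((h / K) ^ n) ^ 2 * (2 * (∫ t, ‖f t‖ ^ 2) *
        ∫ q : ℝ × ℝ, ‖iteratedDeriv n (fun s => v (q.1, s)) q.2‖ ^ 2) := by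
  by_cases hi : Integrable fun p : ℝ × ℝ => ‖(φ p.1 : ℂ) * Fh h (Xv f v a p.2) p.1‖ ^ 2
  swap
  · rw [integral_undef hi]
    positivity
  have hvc := hasCompactSupport_of_tsupport_subset_box hs
  obtain ⟨hm, hm'⟩ := integrable_integral_waveletMass hf hfc ha
  simp_rw [iteratedDeriv_slice hv]
  rw [Measure.volume_eq_prod] at hi
  set Q := ∫ q : ℝ × ℝ, ‖partialSnd^[n] v (q.1, q.2)‖ ^ 2 with hQ
  have hmono : ∀ b, ∫ ξ, ‖(φ ξ : ℂ) * Fh h (Xv f v a b) ξ‖ ^ 2 ≤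
      (((h / K) ^ n) ^ 2 * |a|⁻¹ * Q) * waveletMass f a b := fun b => by
    refine (integral_norm_sq_cutoff_mul_Fh_le hh hK hφ hφK (contDiff_Xv hf hfc hv hvc ha b)
      (hasCompactSupport_Xv f hs a b) n).trans ?_
    rw [iteratedDeriv_Xv hf hfc hv hvc ha]
    refine (mul_le_mul_of_nonneg_left (integral_norm_sq_Xv_le hf hfc
      (contDiff_iterate_partialSnd hv n).continuous
      ((tsupport_iterate_partialSnd v n).trans hs) a b) (by positivity)).trans_eq ?_
    rw [hQ]
    ring
  rw [Measure.volume_eq_prod, integral_prod_symm _ hi]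
  refine (integral_mono_of_nonneg (ae_of_all _ fun b => by positivity) (hm.const_mul _)
    (ae_of_all _ hmono)).trans_eq ?_
  rw [integral_const_mul, hm']
  have : |a| ≠ 0 := abs_ne_zero.2 ha
  field_simp

/-- Dyadic wavelet-coefficient estimate at large scales `|a| ≥ 1`: if `v` is
supported in `[-1,1]²` and is a strong order-`h` quasimode of `h^{k+1}D_{x₂}^{k+1}`
of size `N`, i.e. `‖(h^{k+1}∂_{x₂}^{k+1})^{M} v‖_{L²} ≤ A_M h^M N` for all `M`, then
`‖χ(2⁻ʲh^{-1/(k+1)}|ξ₂|) F_h[X_v(a,b,·)](ξ₂)‖_{L²(dξ₂ db)} ≤ C_M 2^{-jM} N`. -/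
theorem Xv_dyadic_L2_bound_large_a
    (k : ℕ) (hk : 1 ≤ k) (A : ℕ → ℝ)
    (f : ℝ → ℂ) (hf : ContDiff ℝ (⊤ : ℕ∞) f) (hfc : HasCompactSupport f)
    (χ : ℝ → ℝ) (hχ : ContDiff ℝ (⊤ : ℕ∞) χ)
    (hχ0 : ∀ t, 0 ≤ χ t) (hχ1 : ∀ t, χ t ≤ 1)
    (hχs : tsupport χ ⊆ Set.Icc (1 / 2 : ℝ) (3 / 2))
    (M : ℕ) :
    ∃ C : ℝ, 0 < C ∧
      ∀ h : ℝ, 0 < h → h ≤ 1 → ∀ N : ℝ, 0 < N →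
      ∀ v : ℝ × ℝ → ℂ, ContDiff ℝ (⊤ : ℕ∞) v →
        tsupport v ⊆ Set.Icc (-1 : ℝ) 1 ×ˢ Set.Icc (-1 : ℝ) 1 →
      -- strong quasimode hypothesis: ‖(h^{k+1}∂_{x₂}^{k+1})^{M'} v‖_{L²} ≤ A_{M'} h^{M'} N
      (∀ M' : ℕ,
        h ^ ((k + 1) * M') *
            (∫ q : ℝ × ℝ,
                ‖iteratedDeriv ((k + 1) * M') (fun s => v (q.1, s)) q.2‖ ^ 2) ^
              ((1 : ℝ) / 2) ≤
          A M' * h ^ M' * N) →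
      ∀ j : ℕ, 1 ≤ j → ∀ a : ℝ, 1 ≤ |a| →
        (∫ p : ℝ × ℝ,
            ‖((χ ((2 : ℝ) ^ (-(j : ℝ)) * h ^ (-(1 / ((k : ℝ) + 1))) * |p.1|) : ℝ) : ℂ) *
                Fh h (Xv f v a p.2) p.1‖ ^ 2) ^ ((1 : ℝ) / 2) ≤
          C * (2 : ℝ) ^ (-((j : ℝ) * (M : ℝ))) * N := by
  set S := √(2 * ∫ t, ‖f t‖ ^ 2) with hS
  refine ⟨S * |A M| * 2 ^ M + 1, by positivity, ?_⟩
  intro h hh _ N hN v hv hs hquasi j hj a ha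
  have ha0 : a ≠ 0 := by
    rintro rfl
    norm_num at ha
  set r := h ^ (1 / ((k : ℝ) + 1)) with hr
  have hr0 : 0 < r := rpow_pos_of_pos hh _
  have hrk : r ^ (k + 1) = h := by
    rw [hr, ← rpow_natCast, ← rpow_mul hh.le]
    push_cast
    rw [one_div_mul_cancel (by positivity), rpow_one]
  obtain ⟨i, rfl⟩ : ∃ i, j = i + 1 := ⟨j - 1, by omega⟩
  have hK : 0 < 2 ^ i * r := by positivity
  set φ : ℝ → ℝ := fun ξ => χ ((2 : ℝ) ^ (-((i + 1 : ℕ) : ℝ)) * h ^ (-(1 / ((k : ℝ) + 1))) * |ξ|)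
  have hφ : ∀ ξ, |φ ξ| ≤ 1 := fun ξ => by
    rw [abs_of_nonneg (hχ0 _)]
    exact hχ1 _
  have hφK : ∀ ξ, |ξ| < 2 ^ i * r → φ ξ = 0 := fun ξ hξ => by
    refine image_eq_zero_of_notMem_tsupport (f := χ) fun hm => ?_
    have h1 := (hχs hm).1
    rw [rpow_neg (by norm_num), rpow_natCast, rpow_neg hh.le, ← hr, pow_succ,
      ← mul_inv, inv_mul_eq_div, le_div_iff₀ (by positivity)] at h1
    linarith
  have hmain := integral_norm_sq_cutoff_mul_Fh_Xv_le hh hK ha0 hφ hφK hf.continuous hfc hv hs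
    ((k + 1) * M)
  have hq := hquasi M
  set Q := ∫ q : ℝ × ℝ, ‖iteratedDeriv ((k + 1) * M) (fun s => v (q.1, s)) q.2‖ ^ 2
  rw [← sqrt_eq_rpow] at hq ⊢
  have hKpow : (2 ^ i * r) ^ ((k + 1) * M) = (2 ^ i) ^ ((k + 1) * M) * h ^ M := by
    rw [mul_pow, pow_mul r, hrk]
  have hpow : ((2 : ℝ) ^ i) ^ M ≤ (2 ^ i) ^ ((k + 1) * M) :=
    pow_le_pow_right₀ (one_le_pow₀ (by norm_num)) (by nlinarith)
  have hexp : (2 : ℝ) ^ (-(((i + 1 : ℕ) : ℝ) * (M : ℝ))) = (2 ^ M * (2 ^ i) ^ M)⁻¹ := by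
    rw [rpow_neg (by norm_num), ← Nat.cast_mul, rpow_natCast, pow_mul, pow_succ, mul_pow, mul_comm]
  calc _ ≤ √(((h / (2 ^ i * r)) ^ ((k + 1) * M)) ^ 2 * (2 * (∫ t, ‖f t‖ ^ 2) * Q)) :=
        sqrt_le_sqrt hmain
    _ = S * ((h ^ ((k + 1) * M) * √Q) / ((2 ^ i) ^ ((k + 1) * M) * h ^ M)) := by
        rw [sqrt_mul (by positivity), sqrt_sq (by positivity), sqrt_mul (by positivity), ← hS,
          div_pow, hKpow]
        ring
    _ ≤ S * ((|A M| * h ^ M * N) / ((2 ^ i) ^ M * h ^ M)) := by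
        have : A M * h ^ M * N ≤ |A M| * h ^ M * N := by
          gcongr
          exact le_abs_self _
        have := hq.trans this
        gcongr
    _ = S * |A M| * 2 ^ M * (2 ^ M * (2 ^ i) ^ M)⁻¹ * N := by
        field_simp
    _ ≤ _ := by
        rw [hexp]
        gcongr
        linarith
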